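/- Let Λ = {Λ_ω ∈ B(H,E)} be a dual of the continuous g-frame Θ = {Θ_ω ∈ B(H,E)} (both continuous g-frames for H with respect to E), and let Ψ = {Ψ_ω ∈ B(K,E)} be a dual of the continuous g-frame Φ = {Φ_ω ∈ B(K,E)} (both continuous g-frames for K with respect to E). Suppose Λ and Φ are strongly disjoint and Θ and Ψ are strongly disjoint. Define Γ_ω(h ⊕ k) = Λ_ω h + Ψ_ω k and Δ_ω(h ⊕ k) = Θ_ω h + Φ_ω k on the Hilbert direct sum H ⊕ K. Then Γ = {Γ_ω : ω ∈ Ω} and Δ = {Δ_ω : ω ∈ Ω} are dual continuous g-frames for H ⊕ K, i.e. both are continuous g-frames and ∫_Ω ⟨Γ_ω(h₁ ⊕ k₁), Δ_ω(h₂ ⊕ k₂)⟩ dμ(ω) = ⟨h₁ ⊕ k₁, h₂ ⊕ k₂⟩ for all h₁, h₂ ∈ H, k₁, k₂ ∈ K. -/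

import Mathlib

open MeasureTheory
open scoped ENNReal NNReal Pointwise

noncomputable section

local notation "⟪" x ", " y "⟫" => @inner ℂ _ _ x y

variable {Ω : Type*} [MeasurableSpace Ω]

section Defs

variable {F G E : Type*}
  [NormedAddCommGroup F] [InnerProductSpace ℂ F]
  [NormedAddCommGroup G] [InnerProductSpace ℂ G]
  [NormedAddCommGroup E] [InnerProductSpace ℂ E]

/-- `Λ` is a continuous g-frame for `F` with respect to `E`, with frame bounds `A`, `B`:
for every `f`, `ω ↦ Λ ω f` is strongly measurable and
`A‖f‖² ≤ ∫ ‖Λ ω f‖² dμ(ω) ≤ B‖f‖²`. -/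
def IsCgFrame (μ : Measure Ω) (Λ : Ω → F →L[ℂ] E) (A B : ℝ) : Prop :=
  (∀ f : F, StronglyMeasurable fun ω => Λ ω f) ∧
    ∀ f : F,
      ENNReal.ofReal (A * ‖f‖ ^ 2) ≤ ∫⁻ ω, (‖Λ ω f‖₊ : ℝ≥0∞) ^ 2 ∂μ ∧
        ∫⁻ ω, (‖Λ ω f‖₊ : ℝ≥0∞) ^ 2 ∂μ ≤ ENNReal.ofReal (B * ‖f‖ ^ 2)

/-- `Λ` is a continuous g-Bessel family with Bessel constant `B`. -/
def IsCgBessel (μ : Measure Ω) (Λ : Ω → F →L[ℂ] E) (B : ℝ) : Prop :=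
  (∀ f : F, StronglyMeasurable fun ω => Λ ω f) ∧
    ∀ f : F, ∫⁻ ω, (‖Λ ω f‖₊ : ℝ≥0∞) ^ 2 ∂μ ≤ ENNReal.ofReal (B * ‖f‖ ^ 2)

/-- `Λ` is a tight continuous g-frame with bound `A`. -/
def IsCgTight (μ : Measure Ω) (Λ : Ω → F →L[ℂ] E) (A : ℝ) : Prop :=
  (∀ f : F, StronglyMeasurable fun ω => Λ ω f) ∧
    ∀ f : F, ∫⁻ ω, (‖Λ ω f‖₊ : ℝ≥0∞) ^ 2 ∂μ = ENNReal.ofReal (A * ‖f‖ ^ 2)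

/-- `Λ` is a Parseval continuous g-frame. -/
def IsCgParseval (μ : Measure Ω) (Λ : Ω → F →L[ℂ] E) : Prop :=
  (∀ f : F, StronglyMeasurable fun ω => Λ ω f) ∧
    ∀ f : F, ∫⁻ ω, (‖Λ ω f‖₊ : ℝ≥0∞) ^ 2 ∂μ = ENNReal.ofReal (‖f‖ ^ 2)

/-- The range of the analysis operator `T*_Λ : F → Ê = L²(Ω,μ;E)`, i.e. the set of elements of
`L²(Ω,μ;E)` represented by `ω ↦ Λ ω f` for some `f : F`. -/
def analysisRange (μ : Measure Ω) (Λ : Ω → F →L[ℂ] E) : Set (Lp E 2 μ) :=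
  {φ | ∃ f : F, (fun ω => Λ ω f) =ᵐ[μ] (φ : Ω → E)}

/-- `Λ` and `Θ` are strongly disjoint: the ranges of their analysis operators are orthogonal,
equivalently `∫ ⟨Λ ω h, Θ ω k⟩ dμ(ω) = 0` for all `h`, `k`. -/
def StronglyDisjoint (μ : Measure Ω) (Λ : Ω → F →L[ℂ] E) (Θ : Ω → G →L[ℂ] E) : Prop :=
  ∀ (h : F) (k : G), ∫ ω, ⟪Λ ω h, Θ ω k⟫ ∂μ = 0

/-- `Λ` and `Θ` are disjoint: `Range T*_Λ ∩ Range T*_Θ = {0}` and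
`Range T*_Λ + Range T*_Θ` is closed in `Ê`. -/
def IsDisjoint (μ : Measure Ω) (Λ : Ω → F →L[ℂ] E) (Θ : Ω → G →L[ℂ] E) : Prop :=
  analysisRange μ Λ ∩ analysisRange μ Θ = {(0 : Lp E 2 μ)} ∧
    IsClosed (analysisRange μ Λ + analysisRange μ Θ)

/-- `Λ` and `Θ` are weakly disjoint: `Range T*_Λ ∩ Range T*_Θ = {0}`. -/
def WeaklyDisjoint (μ : Measure Ω) (Λ : Ω → F →L[ℂ] E) (Θ : Ω → G →L[ℂ] E) : Prop :=
  analysisRange μ Λ ∩ analysisRange μ Θ = {(0 : Lp E 2 μ)}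

/-- `Λ` and `Θ` are a complementary pair: `Range T*_Λ ∩ Range T*_Θ = {0}` and
`Range T*_Λ + Range T*_Θ = Ê`. -/
def ComplementaryPair (μ : Measure Ω) (Λ : Ω → F →L[ℂ] E) (Θ : Ω → G →L[ℂ] E) : Prop :=
  analysisRange μ Λ ∩ analysisRange μ Θ = {(0 : Lp E 2 μ)} ∧
    analysisRange μ Λ + analysisRange μ Θ = (Set.univ : Set (Lp E 2 μ))

/-- `Λ` and `Θ` are a strongly complementary pair: `Ê` is the orthogonal direct sum of
`Range T*_Λ` and `Range T*_Θ`. -/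
def StronglyComplementaryPair (μ : Measure Ω) (Λ : Ω → F →L[ℂ] E) (Θ : Ω → G →L[ℂ] E) : Prop :=
  StronglyDisjoint μ Λ Θ ∧
    analysisRange μ Λ + analysisRange μ Θ = (Set.univ : Set (Lp E 2 μ))

/-- `S` is the (continuous g-)frame operator of `Λ`:
`⟨S f, g⟩ = ∫ ⟨Λ ω f, Λ ω g⟩ dμ(ω)`. -/
def IsFrameOperator (μ : Measure Ω) (Λ : Ω → F →L[ℂ] E) (S : F →L[ℂ] F) : Prop :=
  ∀ f g : F, ⟪S f, g⟫ = ∫ ω, ⟪Λ ω f, Λ ω g⟫ ∂μ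

/-- `Θ` is a dual of `Λ`: `∫ ⟨Θ ω f, Λ ω g⟩ dμ(ω) = ⟨f, g⟩` for all `f`, `g`. -/
def IsDualOf (μ : Measure Ω) (Θ Λ : Ω → F →L[ℂ] E) : Prop :=
  ∀ f g : F, ∫ ω, ⟪Θ ω f, Λ ω g⟫ ∂μ = ⟪f, g⟫

/-- `Λ` is a Riesz-type continuous g-frame: it is a continuous g-frame and every dual of `Λ`
is weakly equal to the canonical dual `{Λ_ω S_Λ⁻¹}`, where `S_Λ` is the frame operator. -/
def IsRieszType (μ : Measure Ω) (Λ : Ω → F →L[ℂ] E) : Prop :=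
  (∃ A B : ℝ, 0 < A ∧ IsCgFrame μ Λ A B) ∧
    ∀ S : F ≃L[ℂ] F, IsFrameOperator μ Λ (S : F →L[ℂ] F) →
      ∀ Θ : Ω → F →L[ℂ] E, (∃ A B : ℝ, 0 < A ∧ IsCgFrame μ Θ A B) → IsDualOf μ Θ Λ →
        ∀ f : F, ∀ᵐ ω ∂μ, Θ ω f = Λ ω (S.symm f)

/-- The operator `h ⊕ k ↦ Λω h + Θω k` on the Hilbert direct sum `F ⊕ G = WithLp 2 (F × G)`. -/
def pairMap (Λω : F →L[ℂ] E) (Θω : G →L[ℂ] E) : WithLp 2 (F × G) →L[ℂ] E :=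
  (Λω.comp (ContinuousLinearMap.fst ℂ F G) + Θω.comp (ContinuousLinearMap.snd ℂ F G)).comp
    (WithLp.prodContinuousLinearEquiv 2 ℂ F G).toContinuousLinearMap

end Defs

section Duality

variable {F G E : Type*}
  [NormedAddCommGroup F] [InnerProductSpace ℂ F]
  [NormedAddCommGroup G] [InnerProductSpace ℂ G]
  [NormedAddCommGroup E] [InnerProductSpace ℂ E]
  {μ : Measure Ω} {A B B' : ℝ}

@[simp]
lemma pairMap_apply (S : F →L[ℂ] E) (T : G →L[ℂ] E) (x : WithLp 2 (F × G)) :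
    pairMap S T x = S x.fst + T x.snd :=
  rfl

lemma IsCgFrame.isCgBessel {Λ : Ω → F →L[ℂ] E} (h : IsCgFrame μ Λ A B) : IsCgBessel μ Λ B :=
  ⟨h.1, fun f => (h.2 f).2⟩

lemma IsCgBessel.memLp {Λ : Ω → F →L[ℂ] E} (h : IsCgBessel μ Λ B) (f : F) :
    MemLp (fun ω => Λ ω f) 2 μ := by
  refine ⟨(h.1 f).aestronglyMeasurable, ?_⟩
  rw [eLpNorm_lt_top_iff_lintegral_rpow_enorm_lt_top two_ne_zero ENNReal.ofNat_ne_top]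
  simpa [enorm_eq_nnnorm] using (h.2 f).trans_lt ENNReal.ofReal_lt_top

lemma IsCgBessel.lintegral_eq {Λ : Ω → F →L[ℂ] E} (h : IsCgBessel μ Λ B) (f : F) :
    ∫⁻ ω, (‖Λ ω f‖₊ : ℝ≥0∞) ^ 2 ∂μ = ENNReal.ofReal (∫ ω, ‖Λ ω f‖ ^ 2 ∂μ) := by
  rw [ofReal_integral_eq_lintegral_ofReal (h.memLp f).norm.integrable_sq
    (Filter.Eventually.of_forall fun ω => sq_nonneg _)]
  simp [ENNReal.ofReal_pow, ofReal_norm, enorm_eq_nnnorm]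

lemma IsCgBessel.integral_le {Λ : Ω → F →L[ℂ] E} (h : IsCgBessel μ Λ B) (hB : 0 ≤ B) (f : F) :
    ∫ ω, ‖Λ ω f‖ ^ 2 ∂μ ≤ B * ‖f‖ ^ 2 := by
  have := h.2 f
  rwa [h.lintegral_eq, ENNReal.ofReal_le_ofReal_iff (by positivity)] at this

lemma IsCgBessel.integrable_inner {Λ : Ω → F →L[ℂ] E} {Θ : Ω → G →L[ℂ] E}
    (hΛ : IsCgBessel μ Λ B) (hΘ : IsCgBessel μ Θ B') (f : F) (g : G) :
    Integrable (fun ω => ⟪Λ ω f, Θ ω g⟫) μ := by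
  refine ((hΛ.memLp f).norm.integrable_mul (hΘ.memLp g).norm).mono'
    ((hΛ.memLp f).1.inner (hΘ.memLp g).1) (Filter.Eventually.of_forall fun ω => ?_)
  exact norm_inner_le_norm _ _

lemma IsDualOf.symm {Λ Θ : Ω → F →L[ℂ] E} (h : IsDualOf μ Λ Θ) : IsDualOf μ Θ Λ := by
  intro f g
  rw [← inner_conj_symm f g, ← h g f, ← integral_conj]
  simp only [inner_conj_symm]

lemma StronglyDisjoint.symm {Λ : Ω → F →L[ℂ] E} {Θ : Ω → G →L[ℂ] E}
    (h : StronglyDisjoint μ Λ Θ) : StronglyDisjoint μ Θ Λ := by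
  intro g f
  rw [← map_zero (starRingEnd ℂ), ← h f g, ← integral_conj]
  simp only [inner_conj_symm]

/-- A Bessel family with a Bessel dual is a continuous g-frame. -/
lemma IsCgBessel.isCgFrame_of_isDualOf {Λ Θ : Ω → F →L[ℂ] E}
    (hΛ : IsCgBessel μ Λ B) (hΘ : IsCgBessel μ Θ B') (hB' : 0 < B') (h : IsDualOf μ Λ Θ) :
    IsCgFrame μ Λ B'⁻¹ B := by
  refine ⟨hΛ.1, fun f => ⟨?_, hΛ.2 f⟩⟩
  rw [hΛ.lintegral_eq]
  refine ENNReal.ofReal_le_ofReal ?_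
  have iΛ := (hΛ.memLp f).norm.integrable_sq
  have iΘ := (hΘ.memLp f).norm.integrable_sq
  have key : ‖f‖ ^ 2 ≤ ∫ ω, (B' / 2 * ‖Λ ω f‖ ^ 2 + (2 * B')⁻¹ * ‖Θ ω f‖ ^ 2) ∂μ := by
    have hnorm : ‖f‖ ^ 2 = ‖∫ ω, ⟪Λ ω f, Θ ω f⟫ ∂μ‖ := by
      rw [h f f, inner_self_eq_norm_sq_to_K]
      simp
    rw [hnorm]
    refine norm_integral_le_of_norm_le ((iΛ.const_mul _).add (iΘ.const_mul _))
      (Filter.Eventually.of_forall fun ω => (norm_inner_le_norm _ _).trans ?_)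
    have hsq : B' / 2 * ‖Λ ω f‖ ^ 2 + (2 * B')⁻¹ * ‖Θ ω f‖ ^ 2 - ‖Λ ω f‖ * ‖Θ ω f‖
        = (2 * B')⁻¹ * (B' * ‖Λ ω f‖ - ‖Θ ω f‖) ^ 2 := by
      field_simp
      ring
    have : 0 ≤ (2 * B')⁻¹ * (B' * ‖Λ ω f‖ - ‖Θ ω f‖) ^ 2 := by positivity
    linarith
  rw [integral_add (iΛ.const_mul _) (iΘ.const_mul _), integral_const_mul,
    integral_const_mul] at key
  have hle : (2 * B')⁻¹ * ∫ ω, ‖Θ ω f‖ ^ 2 ∂μ ≤ ‖f‖ ^ 2 / 2 :=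
    calc (2 * B')⁻¹ * ∫ ω, ‖Θ ω f‖ ^ 2 ∂μ ≤ (2 * B')⁻¹ * (B' * ‖f‖ ^ 2) := by
          gcongr
          exact hΘ.integral_le hB'.le f
      _ = ‖f‖ ^ 2 / 2 := by field_simp
  rw [inv_mul_le_iff₀ hB']
  linarith

lemma IsCgBessel.pairMap {Λ : Ω → F →L[ℂ] E} {Θ : Ω → G →L[ℂ] E}
    (hΛ : IsCgBessel μ Λ B) (hΘ : IsCgBessel μ Θ B') :
    IsCgBessel μ (fun ω => pairMap (Λ ω) (Θ ω)) (2 * max 1 (max B B')) := by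
  refine ⟨fun x => (hΛ.1 x.fst).add (hΘ.1 x.snd), fun x => ?_⟩
  set M := max 1 (max B B')
  have hM : 0 ≤ M := zero_le_one.trans (le_max_left _ _)
  have hBM : B ≤ M := (le_max_left _ _).trans (le_max_right _ _)
  have hBM' : B' ≤ M := (le_max_right _ _).trans (le_max_right _ _)
  calc ∫⁻ ω, (‖_root_.pairMap (Λ ω) (Θ ω) x‖₊ : ℝ≥0∞) ^ 2 ∂μ
      ≤ ∫⁻ ω, (2 * (‖Λ ω x.fst‖₊ : ℝ≥0∞) ^ 2 + 2 * (‖Θ ω x.snd‖₊ : ℝ≥0∞) ^ 2) ∂μ := by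
        refine lintegral_mono fun ω => ?_
        rw [← mul_add]
        norm_cast
        refine ENNReal.coe_le_coe.2 ?_
        exact (pow_le_pow_left₀ zero_le (nnnorm_add_le (Λ ω x.fst) (Θ ω x.snd)) 2).trans add_sq_le
    _ = 2 * ∫⁻ ω, (‖Λ ω x.fst‖₊ : ℝ≥0∞) ^ 2 ∂μ + 2 * ∫⁻ ω, (‖Θ ω x.snd‖₊ : ℝ≥0∞) ^ 2 ∂μ := by
        have m₁ := (hΛ.1 x.fst).enorm.pow_const 2
        have m₂ := (hΘ.1 x.snd).enorm.pow_const 2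
        simp only [enorm_eq_nnnorm] at m₁ m₂
        rw [lintegral_add_left (m₁.const_mul 2), lintegral_const_mul _ m₁, lintegral_const_mul _ m₂]
    _ ≤ 2 * ENNReal.ofReal (M * ‖x.fst‖ ^ 2) + 2 * ENNReal.ofReal (M * ‖x.snd‖ ^ 2) := by
        gcongr
        · exact (hΛ.2 _).trans (ENNReal.ofReal_le_ofReal (by gcongr))
        · exact (hΘ.2 _).trans (ENNReal.ofReal_le_ofReal (by gcongr))
    _ = ENNReal.ofReal (2 * M * ‖x‖ ^ 2) := by
        rw [WithLp.prod_norm_sq_eq_of_L2, mul_assoc, ENNReal.ofReal_mul zero_le_two,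
          ENNReal.ofReal_ofNat, mul_add M, ENNReal.ofReal_add (by positivity) (by positivity),
          mul_add]

lemma IsDualOf.pairMap {Λ Θ : Ω → F →L[ℂ] E} {Ψ Φ : Ω → G →L[ℂ] E} {BΛ BΘ BΨ BΦ : ℝ}
    (hΛ : IsCgBessel μ Λ BΛ) (hΘ : IsCgBessel μ Θ BΘ)
    (hΨ : IsCgBessel μ Ψ BΨ) (hΦ : IsCgBessel μ Φ BΦ)
    (hΛΘ : IsDualOf μ Λ Θ) (hΨΦ : IsDualOf μ Ψ Φ)
    (hΛΦ : StronglyDisjoint μ Λ Φ) (hΘΨ : StronglyDisjoint μ Θ Ψ) :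
    IsDualOf μ (fun ω => pairMap (Λ ω) (Ψ ω)) (fun ω => pairMap (Θ ω) (Φ ω)) := by
  intro x y
  simp only [pairMap_apply, inner_add_left, inner_add_right]
  rw [integral_add (by exact (hΛ.integrable_inner hΘ _ _).add (hΨ.integrable_inner hΘ _ _))
      (by exact (hΛ.integrable_inner hΦ _ _).add (hΨ.integrable_inner hΦ _ _)),
    integral_add (hΛ.integrable_inner hΘ _ _) (hΨ.integrable_inner hΘ _ _),
    integral_add (hΛ.integrable_inner hΦ _ _) (hΨ.integrable_inner hΦ _ _),
    hΛΘ, hΨΦ, hΛΦ, hΘΨ.symm, add_zero, zero_add]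
  exact (WithLp.prod_inner_apply x y).symm

end Duality

variable {H K E : Type*}
  [NormedAddCommGroup H] [InnerProductSpace ℂ H] [CompleteSpace H]
  [NormedAddCommGroup K] [InnerProductSpace ℂ K] [CompleteSpace K]
  [NormedAddCommGroup E] [InnerProductSpace ℂ E] [CompleteSpace E]

/-- if `Λ` is a dual of `Θ` (g-frames for `H`), `Ψ` is a dual of `Φ`
(g-frames for `K`), `Λ, Φ` are strongly disjoint and `Θ, Ψ` are strongly disjoint, then
`Γ_ω (h ⊕ k) = Λ_ω h + Ψ_ω k` and `Δ_ω (h ⊕ k) = Θ_ω h + Φ_ω k` are dual continuous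
g-frames for `H ⊕ K`. -/
theorem stmt11 (μ : Measure Ω) (Λ Θ : Ω → H →L[ℂ] E) (Ψ Φ : Ω → K →L[ℂ] E)
    (AL BL AT BT AP BP AF BF : ℝ)
    (hAL : 0 < AL) (hAT : 0 < AT) (hAP : 0 < AP) (hAF : 0 < AF)
    (hL : IsCgFrame μ Λ AL BL) (hT : IsCgFrame μ Θ AT BT)
    (hP : IsCgFrame μ Ψ AP BP) (hF : IsCgFrame μ Φ AF BF)
    (hdual1 : IsDualOf μ Λ Θ) (hdual2 : IsDualOf μ Ψ Φ)
    (hdis1 : StronglyDisjoint μ Λ Φ) (hdis2 : StronglyDisjoint μ Θ Ψ) :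
    (∃ A B : ℝ, 0 < A ∧ IsCgFrame μ (fun ω => pairMap (Λ ω) (Ψ ω)) A B) ∧
    (∃ A B : ℝ, 0 < A ∧ IsCgFrame μ (fun ω => pairMap (Θ ω) (Φ ω)) A B) ∧
    ∀ x y : WithLp 2 (H × K),
      ∫ ω, ⟪pairMap (Λ ω) (Ψ ω) x, pairMap (Θ ω) (Φ ω) y⟫ ∂μ = ⟪x, y⟫ := by
  have bΓ := hL.isCgBessel.pairMap hP.isCgBessel
  have bΔ := hT.isCgBessel.pairMap hF.isCgBessel
  have dual := hdual1.pairMap hL.isCgBessel hT.isCgBessel hP.isCgBessel hF.isCgBessel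
    hdual2 hdis1 hdis2
  have pos (a : ℝ) : 0 < 2 * max 1 a := by positivity
  exact ⟨⟨_, _, inv_pos.2 (pos _), bΓ.isCgFrame_of_isDualOf bΔ (pos _) dual⟩,
    ⟨_, _, inv_pos.2 (pos _), bΔ.isCgFrame_of_isDualOf bΓ (pos _) dual.symm⟩, dual⟩
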